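/- Let p be a prime and a, b integers with 0 ≤ b ≤ a and a ≢ b (mod p−1). Then the sequence e ↦ S(p^e·a, p^e·b), viewed in ℤ_p, converges to 0 as e → ∞. -/

import Mathlib

/-- Stirling numbers of the second kind for integer arguments:
`S(n,k) = (1/k!) ∑_{i=0}^{k} (-1)^(k-i) C(k,i) i^n` for `n, k ≥ 0` (with `0^0 = 1`),
and `S(n,k) = 0` if `n < 0` or `k < 0`. -/
def stirling2 (n k : ℤ) : ℤ :=
  if n < 0 ∨ k < 0 then 0
  else (∑ i ∈ Finset.range (k.toNat + 1),
      (-1 : ℤ) ^ (k.toNat - i) * (Nat.choose k.toNat i : ℤ) * (i : ℤ) ^ n.toNat)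
    / (Nat.factorial k.toNat : ℤ)

/-- The explicit formula for the Stirling numbers of the second kind. -/
theorem sum_choose_mul_pow_eq_factorial_mul_stirlingSecond (n k : ℕ) :
    ∑ i ∈ Finset.range (k + 1), (-1 : ℤ) ^ (k - i) * (Nat.choose k i : ℤ) * (i : ℤ) ^ n
      = (k.factorial : ℤ) * (Nat.stirlingSecond n k : ℤ) := by
  induction n generalizing k with
  | zero =>
    have h := Int.alternating_sum_range_choose (n := k)
    rw [← Finset.sum_range_reflect] at h
    have h' : ∑ i ∈ Finset.range (k + 1), (-1 : ℤ) ^ (k - i) * (Nat.choose k i : ℤ) =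
        if k = 0 then 1 else 0 := by
      rw [← h]
      refine Finset.sum_congr rfl fun i hi => ?_
      have hi : i ≤ k := Nat.lt_succ_iff.mp (Finset.mem_range.mp hi)
      rw [show k + 1 - 1 - i = k - i by omega, Nat.choose_symm hi]
    cases k <;> simp_all
  | succ n ih =>
    cases k with
    | zero => simp
    | succ k =>
      have e1 : ∑ i ∈ Finset.range (k + 1 + 1),
          (-1 : ℤ) ^ (k + 1 - i) * (Nat.choose (k + 1) i : ℤ) * (i : ℤ) ^ (n + 1)
          = (k + 1) * ∑ i ∈ Finset.range (k + 1 + 1),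
              (-1 : ℤ) ^ (k + 1 - i) * (Nat.choose (k + 1) i : ℤ) * (i : ℤ) ^ n
            - (k + 1) * ∑ i ∈ Finset.range (k + 1 + 1),
              (-1 : ℤ) ^ (k + 1 - i) * (Nat.choose k i : ℤ) * (i : ℤ) ^ n := by
        rw [Finset.mul_sum, Finset.mul_sum, ← Finset.sum_sub_distrib]
        refine Finset.sum_congr rfl fun i _ => ?_
        have hc : (Nat.choose (k + 1) i : ℤ) * i
            = (k + 1) * ((Nat.choose (k + 1) i : ℤ) - Nat.choose k i) := by
          cases i with
          | zero => simp
          | succ i =>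
            have h1 := Nat.add_one_mul_choose_eq k i
            have h2 := Nat.choose_succ_succ k i
            zify at h1 h2
            push_cast at h1 h2 ⊢
            linear_combination (k + 1 : ℤ) * (-h2) - h1
        linear_combination (-1 : ℤ) ^ (k + 1 - i) * (i : ℤ) ^ n * hc
      have e2 : ∑ i ∈ Finset.range (k + 1 + 1),
              (-1 : ℤ) ^ (k + 1 - i) * (Nat.choose k i : ℤ) * (i : ℤ) ^ n
          = -((k.factorial : ℤ) * (Nat.stirlingSecond n k : ℤ)) := by
        rw [Finset.sum_range_succ, Nat.choose_succ_self, ← ih k, ← Finset.sum_neg_distrib]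
        simp only [Nat.cast_zero, mul_zero, zero_mul, add_zero]
        refine Finset.sum_congr rfl fun i hi => ?_
        have hi : i ≤ k := Nat.lt_succ_iff.mp (Finset.mem_range.mp hi)
        rw [Nat.succ_sub hi, pow_succ]
        ring
      rw [e1, e2, ih (k + 1), Nat.stirlingSecond_succ_succ, Nat.factorial_succ]
      push_cast
      ring

theorem stirling2_natCast (n k : ℕ) : stirling2 n k = Nat.stirlingSecond n k := by
  have h : ¬ ((n : ℤ) < 0 ∨ (k : ℤ) < 0) := by omega
  rw [stirling2, if_neg h]
  simp only [Int.toNat_natCast]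
  rw [sum_choose_mul_pow_eq_factorial_mul_stirlingSecond]
  exact Int.mul_ediv_cancel_left _ (by exact_mod_cast k.factorial_ne_zero)

/-- The generating function identity `∑ S(n,k) Xⁿ = X ^ k / ∏_{j=1}^k (1 - j X)`. -/
theorem mk_stirlingSecond_mul_prod (R : Type*) [CommRing R] (k : ℕ) :
    PowerSeries.mk (fun n => (Nat.stirlingSecond n k : R)) *
      ∏ j ∈ Finset.range k, (1 - PowerSeries.C ((j + 1 : ℕ) : R) * PowerSeries.X)
      = PowerSeries.X ^ k := by
  induction k with
  | zero =>
    ext n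
    cases n <;> simp [PowerSeries.coeff_one]
  | succ k ih =>
    have h : PowerSeries.mk (fun n => (Nat.stirlingSecond n (k + 1) : R)) *
        (1 - PowerSeries.C ((k + 1 : ℕ) : R) * PowerSeries.X)
        = PowerSeries.mk (fun n => (Nat.stirlingSecond n k : R)) * PowerSeries.X := by
      ext n
      rw [mul_sub, mul_one, mul_left_comm, ← mul_assoc, mul_assoc]
      cases n with
      | zero => simp
      | succ n =>
        simp only [map_sub, PowerSeries.coeff_succ_mul_X, PowerSeries.coeff_C_mul,
          PowerSeries.coeff_mk, Nat.stirlingSecond_succ_succ]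
        push_cast
        ring
    rw [Finset.prod_range_succ, mul_comm (∏ j ∈ Finset.range k, _), ← mul_assoc, h, pow_succ, ← ih]
    ring

theorem prod_range_natCast_succ_zmod {M : Type*} [CommMonoid M] (N b : ℕ) [NeZero N]
    (f : ZMod N → M) :
    ∏ j ∈ Finset.range (N * b), f ((j + 1 : ℕ) : ZMod N) = (∏ x, f x) ^ b := by
  have h : ∏ j ∈ Finset.range N, f ((j + 1 : ℕ) : ZMod N) = ∏ x, f x := by
    rw [← Equiv.prod_comp (Equiv.addRight (1 : ZMod N)) f]
    refine Finset.prod_bij' (fun j _ => (j : ZMod N)) (fun x _ => x.val)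
      (fun _ _ => Finset.mem_univ _) (fun x _ => Finset.mem_range.mpr x.val_lt)
      (fun j hj => ZMod.val_cast_of_lt (Finset.mem_range.mp hj))
      (fun x _ => ZMod.natCast_zmod_val x) (fun j _ => by simp)
  induction b with
  | zero => simp
  | succ b ih =>
    rw [Nat.mul_succ, Finset.prod_range_add, ih, pow_succ, ← h]
    simp [add_assoc]

/-- If `N ∣ k`, then `S(n,k)` modulo `N` is annihilated by
`g ^ n - g ^ k` for every unit `g` modulo `N`. -/
theorem pow_mul_stirlingSecond_zmod {N : ℕ} [NeZero N] (g : (ZMod N)ˣ) (n b : ℕ) :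
    (g : ZMod N) ^ n * (Nat.stirlingSecond n (N * b) : ZMod N)
      = (g : ZMod N) ^ (N * b) * (Nat.stirlingSecond n (N * b) : ZMod N) := by
  set F : PowerSeries (ZMod N) := PowerSeries.mk (fun n => (Nat.stirlingSecond n (N * b) : ZMod N))
    with hF
  set P : PowerSeries (ZMod N) :=
    (∏ x : ZMod N, (1 - PowerSeries.C x * PowerSeries.X)) ^ b with hP
  have hFP : F * P = PowerSeries.X ^ (N * b) := by
    rw [← mk_stirlingSecond_mul_prod, hP, ← prod_range_natCast_succ_zmod N b
      (fun x => (1 - PowerSeries.C x * PowerSeries.X : PowerSeries (ZMod N)))]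
  have hPg : PowerSeries.rescale (g : ZMod N) P = P := by
    rw [hP, map_pow, map_prod]
    congr 1
    rw [← Equiv.prod_comp g.mulRight (fun x => (1 - PowerSeries.C x * PowerSeries.X :
      PowerSeries (ZMod N)))]
    refine Finset.prod_congr rfl fun x _ => ?_
    have hC : PowerSeries.rescale (g : ZMod N) (PowerSeries.C x) = PowerSeries.C x := by
      ext m
      cases m <;> simp [PowerSeries.coeff_rescale, PowerSeries.coeff_C]
    simp [PowerSeries.rescale_X, hC, mul_assoc]
  have hPu : IsUnit P := by
    rw [PowerSeries.isUnit_iff_constantCoeff]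
    simp [hP]
  have key : PowerSeries.rescale (g : ZMod N) F = PowerSeries.C ((g : ZMod N) ^ (N * b)) * F := by
    apply hPu.mul_right_cancel
    conv_lhs => rw [← hPg]
    rw [← map_mul, mul_assoc, hFP, map_pow, PowerSeries.rescale_X, mul_pow, map_pow]
  have hcoeff := congrArg (PowerSeries.coeff n) key
  rwa [PowerSeries.coeff_rescale, PowerSeries.coeff_C_mul, hF, PowerSeries.coeff_mk] at hcoeff

theorem pow_dvd_stirlingSecond_of_not_modEq {p : ℕ} [Fact p.Prime] (e n b : ℕ)
    (h : ¬ n ≡ p ^ e * b [MOD p - 1]) : p ^ e ∣ Nat.stirlingSecond n (p ^ e * b) := by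
  have hp : p.Prime := Fact.out
  have : NeZero (p ^ e) := ⟨pow_ne_zero _ hp.ne_zero⟩
  obtain ⟨u, hu⟩ := IsCyclic.exists_generator (α := (ZMod p)ˣ)
  have hord : orderOf u = p - 1 := by
    rw [orderOf_eq_card_of_forall_mem_zpowers hu, Nat.card_eq_fintype_card, ZMod.card_units]
  set g : ℕ := (u : ZMod p).val
  have hgu : (g : ZMod p) = u := ZMod.natCast_zmod_val _
  have hg : g.Coprime (p ^ e) := (ZMod.val_coe_unit_coprime u).pow_right e
  have hmul := pow_mul_stirlingSecond_zmod (ZMod.unitOfCoprime g hg) n b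
  rw [ZMod.coe_unitOfCoprime, ← sub_eq_zero, ← sub_mul] at hmul
  have hdvd : ((p ^ e : ℕ) : ℤ) ∣
      ((g : ℤ) ^ n - (g : ℤ) ^ (p ^ e * b)) * (Nat.stirlingSecond n (p ^ e * b) : ℤ) := by
    rw [← ZMod.intCast_zmod_eq_zero_iff_dvd]
    exact_mod_cast hmul
  have hcop : IsCoprime ((p ^ e : ℕ) : ℤ) ((g : ℤ) ^ n - (g : ℤ) ^ (p ^ e * b)) := by
    push_cast
    refine IsCoprime.pow_left ((Nat.prime_iff_prime_int.mp hp).irreducible.coprime_iff_not_dvd.mpr ?_)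
    intro hd
    rw [← ZMod.intCast_zmod_eq_zero_iff_dvd] at hd
    push_cast at hd
    rw [hgu, sub_eq_zero] at hd
    apply h
    rw [← hord, ← pow_eq_pow_iff_modEq]
    exact Units.ext (by exact_mod_cast hd)
  exact_mod_cast hcop.dvd_of_dvd_mul_left hdvd

theorem padic_limit_stirling2_zero_of_not_modEq (p : ℕ) [Fact p.Prime] (a b : ℤ)
    (hb : 0 ≤ b) (hba : b ≤ a) (hab : ¬ Int.ModEq ((p : ℤ) - 1) a b) :
    Filter.Tendsto
      (fun e : ℕ => ((stirling2 ((p : ℤ) ^ e * a) ((p : ℤ) ^ e * b) : ℤ) : ℤ_[p]))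
      Filter.atTop (nhds 0) := by
  have hp : p.Prime := Fact.out
  lift a to ℕ using hb.trans hba
  lift b to ℕ using hb
  have hp1 : ((p - 1 : ℕ) : ℤ) = (p : ℤ) - 1 := by
    rw [Nat.cast_sub hp.one_le, Nat.cast_one]
  have hpow (e c : ℕ) : p ^ e * c ≡ c [MOD p - 1] := by
    have h : p ≡ 1 [MOD p - 1] := ((Nat.modEq_iff_dvd' hp.one_le).mpr dvd_rfl).symm
    simpa using (h.pow e).mul_right c
  have hdvd (e : ℕ) : ((p ^ e : ℕ) : ℤ) ∣ stirling2 ((p : ℤ) ^ e * a) ((p : ℤ) ^ e * b) := by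
    rw [← Nat.cast_pow, ← Nat.cast_mul, ← Nat.cast_mul, stirling2_natCast]
    refine Int.natCast_dvd_natCast.mpr (pow_dvd_stirlingSecond_of_not_modEq e _ b fun h => hab ?_)
    rw [← hp1, Int.natCast_modEq_iff]
    exact (hpow e a).symm.trans (h.trans (hpow e b))
  have hnorm (e : ℕ) :
      ‖((stirling2 ((p : ℤ) ^ e * a) ((p : ℤ) ^ e * b) : ℤ) : ℤ_[p])‖ ≤ ((p : ℝ)⁻¹) ^ e := by
    have h := (PadicInt.norm_int_le_pow_iff_dvd (p := p) (n := e)).mpr (by exact_mod_cast hdvd e)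
    simpa using h
  refine squeeze_zero_norm hnorm (tendsto_pow_atTop_nhds_zero_of_lt_one (by positivity) ?_)
  exact inv_lt_one_of_one_lt₀ (by exact_mod_cast hp.one_lt)
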